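/- arXiv:1409.4917 — 2 statements merged into one kernel-verified Lean document; each statement's English description precedes it below -/
import Mathlib

section
/- There exist compact metric spaces (X,d_X) and (Y,d_Y), continuous maps F: X → X and f: Y → Y, and a continuous surjection π: X → Y satisfying π ∘ F = f ∘ π, such that (Y,f) is distributionally chaotic of type 1 (there is an uncountable set S ⊆ Y such that every pair of distinct points of S is distributionally scrambled of type 1), while (X,F) possesses no pair of distinct points that is distributionally scrambled of type 2 (and hence none of type 1). -/
open Filter Metric
open scoped Classical

/-- The lower distribution function of a pair `(x, y)` under the map `f`:
`Φ_{(x,y)}(δ) = liminf_{m→∞} (1/m)·#{k : 0 < k < m, d(f^k x, f^k y) < δ}`. -/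
noncomputable def lowerDF {X : Type*} [MetricSpace X] (f : X → X) (x y : X) (δ : ℝ) : ℝ :=
  liminf (fun m : ℕ =>
    (((Finset.Ioo 0 m).filter fun k => dist (f^[k] x) (f^[k] y) < δ).card : ℝ) / m) atTop

/-- The upper distribution function of a pair `(x, y)` under the map `f`:
`Φ*_{(x,y)}(δ) = limsup_{m→∞} (1/m)·#{k : 0 < k < m, d(f^k x, f^k y) < δ}`. -/
noncomputable def upperDF {X : Type*} [MetricSpace X] (f : X → X) (x y : X) (δ : ℝ) : ℝ :=
  limsup (fun m : ℕ =>
    (((Finset.Ioo 0 m).filter fun k => dist (f^[k] x) (f^[k] y) < δ).card : ℝ) / m) atTop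

/-- A pair of distinct points is distributionally scrambled of type 1 if `Φ* ≡ 1`
and `Φ(δ) = 0` for some `0 < δ ≤ diam X`. -/
def DistScrambled1 {X : Type*} [MetricSpace X] (f : X → X) (x y : X) : Prop :=
  x ≠ y ∧ (∀ δ > 0, upperDF f x y δ = 1) ∧
    ∃ δ, 0 < δ ∧ δ ≤ diam (Set.univ : Set X) ∧ lowerDF f x y δ = 0

/-- A pair of distinct points is distributionally scrambled of type 2 if `Φ* ≡ 1`
and `Φ(δ) < Φ*(δ)` for some `δ > 0`. -/
def DistScrambled2 {X : Type*} [MetricSpace X] (f : X → X) (x y : X) : Prop :=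
  x ≠ y ∧ (∀ δ > 0, upperDF f x y δ = 1) ∧
    ∃ δ > 0, lowerDF f x y δ < upperDF f x y δ

/-- A pair of distinct points is distributionally scrambled of type 3 if
`Φ(δ) < Φ*(δ)` for some `δ > 0`. -/
def DistScrambled3 {X : Type*} [MetricSpace X] (f : X → X) (x y : X) : Prop :=
  x ≠ y ∧ ∃ δ > 0, lowerDF f x y δ < upperDF f x y δ

open Topology

/-! ### Distribution functions -/

section DistributionFunctions

variable {X : Type*} [MetricSpace X] {f : X → X} {x y : X} {δ : ℝ}

/-- The proportion of times `0 < k < m` at which the orbits of `x` and `y` are `δ`-close. -/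
noncomputable def closeRatio (f : X → X) (x y : X) (δ : ℝ) (m : ℕ) : ℝ :=
  (((Finset.Ioo 0 m).filter fun k => dist (f^[k] x) (f^[k] y) < δ).card : ℝ) / m

lemma closeRatio_nonneg (m : ℕ) : 0 ≤ closeRatio f x y δ m := by
  unfold closeRatio; positivity

lemma closeRatio_le_one (m : ℕ) : closeRatio f x y δ m ≤ 1 := by
  unfold closeRatio
  refine div_le_one_of_le₀ ?_ (Nat.cast_nonneg m)
  have h := Finset.card_filter_le (Finset.Ioo 0 m) fun k => dist (f^[k] x) (f^[k] y) < δ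
  rw [Nat.card_Ioo] at h
  exact_mod_cast h.trans (by omega)

lemma isBoundedUnder_le_closeRatio :
    IsBoundedUnder (· ≤ ·) atTop (closeRatio f x y δ) :=
  isBoundedUnder_of ⟨1, closeRatio_le_one⟩

lemma isBoundedUnder_ge_closeRatio :
    IsBoundedUnder (· ≥ ·) atTop (closeRatio f x y δ) :=
  isBoundedUnder_of ⟨0, closeRatio_nonneg⟩

lemma upperDF_le_one : upperDF f x y δ ≤ 1 :=
  limsup_le_of_le isBoundedUnder_ge_closeRatio.isCoboundedUnder_le
    (Eventually.of_forall closeRatio_le_one)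

lemma lowerDF_nonneg : 0 ≤ lowerDF f x y δ :=
  le_liminf_of_le isBoundedUnder_le_closeRatio.isCoboundedUnder_ge
    (Eventually.of_forall closeRatio_nonneg)

lemma upperDF_le_of_eventually {a : ℝ} (ha : 0 ≤ a)
    (h : ∀ᶠ m : ℕ in atTop,
      (((Finset.Ioo 0 m).filter fun k => dist (f^[k] x) (f^[k] y) < δ).card : ℝ) ≤ a * m) :
    upperDF f x y δ ≤ a := by
  refine limsup_le_of_le isBoundedUnder_ge_closeRatio.isCoboundedUnder_le ?_
  filter_upwards [h] with m hm
  exact div_le_of_le_mul₀ (Nat.cast_nonneg m) ha hm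

lemma upperDF_le_zero_of_forall_le (h : ∀ k, δ ≤ dist (f^[k] x) (f^[k] y)) :
    upperDF f x y δ ≤ 0 := by
  refine upperDF_le_of_eventually le_rfl (Eventually.of_forall fun m => ?_)
  simp [Finset.filter_eq_empty_iff.2 fun k _ => (h k).not_gt]

lemma lowerDF_eq_zero_of_frequently
    (h : ∀ η > 0, ∃ᶠ m : ℕ in atTop,
      (((Finset.Ioo 0 m).filter fun k => dist (f^[k] x) (f^[k] y) < δ).card : ℝ) ≤ η * m) :
    lowerDF f x y δ = 0 := by
  refine le_antisymm (le_of_forall_pos_le_add fun η hη => ?_) lowerDF_nonneg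
  rw [zero_add]
  refine liminf_le_of_frequently_le ?_ isBoundedUnder_ge_closeRatio
  exact (h η hη).mono fun m hm => div_le_of_le_mul₀ (Nat.cast_nonneg m) hη.le hm

lemma one_sub_le_closeRatio {η : ℝ} {m : ℕ} (hm : 0 < m)
    (h : (((Finset.Ioo 0 m).filter fun k => ¬ dist (f^[k] x) (f^[k] y) < δ).card : ℝ) + 1
      ≤ η * m) : 1 - η ≤ closeRatio f x y δ m := by
  have hm' : (0 : ℝ) < m := Nat.cast_pos.2 hm
  unfold closeRatio
  rw [le_div_iff₀ hm']
  have h1 := Finset.card_filter_add_card_filter_not (s := Finset.Ioo 0 m)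
    fun k => dist (f^[k] x) (f^[k] y) < δ
  rw [Nat.card_Ioo] at h1
  have h2 : (((Finset.Ioo 0 m).filter fun k => dist (f^[k] x) (f^[k] y) < δ).card : ℝ) +
      ((Finset.Ioo 0 m).filter fun k => ¬ dist (f^[k] x) (f^[k] y) < δ).card + 1 = m := by
    exact_mod_cast (by omega : _ + _ + 1 = m)
  linarith

lemma upperDF_eq_one_of_frequently
    (h : ∀ η > 0, ∃ᶠ m : ℕ in atTop,
      (((Finset.Ioo 0 m).filter fun k => ¬ dist (f^[k] x) (f^[k] y) < δ).card : ℝ) ≤ η * m) :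
    upperDF f x y δ = 1 := by
  refine le_antisymm upperDF_le_one (le_of_forall_sub_le fun η hη => ?_)
  refine le_limsup_of_frequently_le ?_ isBoundedUnder_le_closeRatio
  have hlarge : ∀ᶠ m : ℕ in atTop, 0 < m ∧ 2 / η ≤ m :=
    (eventually_gt_atTop 0).and (tendsto_natCast_atTop_atTop.eventually_ge_atTop _)
  refine ((h (η / 2) (half_pos hη)).and_eventually hlarge).mono fun m hm => ?_
  obtain ⟨hm, hm0, hm1⟩ := hm
  refine one_sub_le_closeRatio hm0 ?_
  rw [div_le_iff₀ hη] at hm1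
  linarith

lemma one_le_lowerDF_of_tendsto
    (h : Tendsto (fun k => dist (f^[k] x) (f^[k] y)) atTop (𝓝 0)) (hδ : 0 < δ) :
    1 ≤ lowerDF f x y δ := by
  refine le_of_forall_sub_le fun η hη => ?_
  refine le_liminf_of_le isBoundedUnder_le_closeRatio.isCoboundedUnder_ge ?_
  obtain ⟨K, hK⟩ := eventually_atTop.1 (h.eventually_lt_const hδ)
  filter_upwards [eventually_gt_atTop 0,
    tendsto_natCast_atTop_atTop.eventually_ge_atTop ((K + 1) / η)] with m hm0 hm1
  refine one_sub_le_closeRatio hm0 ?_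
  have hsub : ((Finset.Ioo 0 m).filter fun k => ¬ dist (f^[k] x) (f^[k] y) < δ) ⊆
      Finset.range K := by
    intro k hk
    rw [Finset.mem_range]
    by_contra hkK
    exact (Finset.mem_filter.1 hk).2 (hK k (not_lt.1 hkK))
  have hcard := Finset.card_le_card hsub
  rw [Finset.card_range] at hcard
  rw [div_le_iff₀ hη] at hm1
  have : (((Finset.Ioo 0 m).filter fun k => ¬ dist (f^[k] x) (f^[k] y) < δ).card : ℝ) ≤ K :=
    Nat.cast_le.2 hcard
  linarith

lemma not_distScrambled2_of_upperDF_lt_one (hδ : 0 < δ) (h : upperDF f x y δ < 1) :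
    ¬ DistScrambled2 f x y := fun hs => h.ne (hs.2.1 δ hδ)

lemma not_distScrambled2_of_tendsto
    (h : Tendsto (fun k => dist (f^[k] x) (f^[k] y)) atTop (𝓝 0)) :
    ¬ DistScrambled2 f x y := by
  rintro ⟨-, -, δ, hδ, hlt⟩
  exact (upperDF_le_one.trans (one_le_lowerDF_of_tendsto h hδ)).not_gt hlt

lemma DistScrambled1.distScrambled2 (h : DistScrambled1 f x y) : DistScrambled2 f x y := by
  obtain ⟨hne, hu, δ, hδ, -, hl⟩ := h
  exact ⟨hne, hu, δ, hδ, by rw [hl, hu δ hδ]; exact one_pos⟩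

end DistributionFunctions

/-! ### The track of a sequence -/

section Track

variable {P : Type*} (p : ℕ → P)

/-- The points `(1 / (n + 1), p n)` together with the limit fibre `{0} × P`. -/
def track : Set (ℝ × P) := {z | z.1 = 0 ∨ ∃ n : ℕ, z = (((n : ℝ) + 1)⁻¹, p n)}

/-- The point `(1 / (n + 1), p n)` of the track of `p`. -/
noncomputable def trackPt (n : ℕ) : track p := ⟨(((n : ℝ) + 1)⁻¹, p n), Or.inr ⟨n, rfl⟩⟩

lemma inv_natCast_add_one_lt_iff {m n : ℕ} : ((m : ℝ) + 1)⁻¹ < ((n : ℝ) + 1)⁻¹ ↔ n < m := by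
  rw [inv_lt_inv₀ (by positivity) (by positivity), add_lt_add_iff_right, Nat.cast_lt]

variable {p} in
lemma track_cases (z : track p) : z.1.1 = 0 ∨ ∃ n, z = trackPt p n :=
  z.2.imp_right fun ⟨n, hn⟩ => ⟨n, Subtype.ext hn⟩

lemma trackPt_injective : Function.Injective (trackPt p) := by
  intro m n h
  have h1 : ((m : ℝ) + 1)⁻¹ = ((n : ℝ) + 1)⁻¹ := congrArg (fun z => z.1.1) h
  exact_mod_cast add_right_cancel (inv_injective h1)

lemma trackPt_fst_pos (n : ℕ) : 0 < (trackPt p n).1.1 := by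
  change 0 < ((n : ℝ) + 1)⁻¹
  positivity

/-- The map moving each point `trackPt p n` to `trackPt p (n + 1)` and fixing the limit fibre. -/
noncomputable def advance (z : track p) : track p :=
  if h : ∃ n, z = trackPt p n then trackPt p (h.choose + 1) else z

lemma advance_trackPt (n : ℕ) : advance p (trackPt p n) = trackPt p (n + 1) := by
  have h : ∃ m, trackPt p n = trackPt p m := ⟨n, rfl⟩
  rw [advance, dif_pos h, ← trackPt_injective p h.choose_spec]

variable {p}

lemma advance_of_fst_eq_zero {z : track p} (hz : z.1.1 = 0) : advance p z = z := by
  refine dif_neg ?_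
  rintro ⟨n, rfl⟩
  exact (trackPt_fst_pos p n).ne' hz

lemma iterate_advance_of_fst_eq_zero {z : track p} (hz : z.1.1 = 0) (k : ℕ) :
    (advance p)^[k] z = z :=
  Function.iterate_fixed (advance_of_fst_eq_zero hz) k

variable (p) in
lemma iterate_advance_trackPt (n k : ℕ) :
    (advance p)^[k] (trackPt p n) = trackPt p (n + k) := by
  induction k with
  | zero => rfl
  | succ k ih => rw [Function.iterate_succ_apply', ih, advance_trackPt, add_assoc]

variable [MetricSpace P]

variable (p) in
lemma isClosed_track : IsClosed (track p) := by
  have h : track p = ⋂ N : ℕ, {z : ℝ × P | 0 ≤ z.1 ∧ z.1 ≤ ((N : ℝ) + 1)⁻¹} ∪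
      (fun n : ℕ => (((n : ℝ) + 1)⁻¹, p n)) '' Set.Iio N := by
    ext z
    simp only [Set.mem_iInter]
    constructor
    · rintro (h | ⟨n, rfl⟩) N
      · exact Or.inl ⟨h.ge, by rw [h]; positivity⟩
      · by_cases hn : n < N
        · exact Or.inr ⟨n, hn, rfl⟩
        · refine Or.inl ⟨by positivity, ?_⟩
          exact not_lt.1 (inv_natCast_add_one_lt_iff.not.2 hn)
    · intro h
      by_contra hz
      have hz' := not_or.1 hz
      have hpos : 0 < z.1 := by
        rcases h 0 with h0 | ⟨n, -, rfl⟩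
        · exact h0.1.lt_of_ne (Ne.symm hz'.1)
        · positivity
      obtain ⟨N, hN⟩ := exists_nat_one_div_lt hpos
      rw [one_div] at hN
      rcases h N with h0 | ⟨n, -, rfl⟩
      · exact h0.2.not_gt hN
      · exact hz'.2 ⟨n, rfl⟩
  rw [h]
  refine isClosed_iInter fun N => IsClosed.union ?_ ((Set.finite_Iio N).image _).isClosed
  exact (isClosed_le continuous_const continuous_fst).inter
    (isClosed_le continuous_fst continuous_const)

variable (p) in
instance compactSpace_track [CompactSpace P] : CompactSpace (track p) := by
  refine isCompact_iff_compactSpace.1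
    (((isCompact_Icc (a := (0 : ℝ)) (b := 1)).prod isCompact_univ).of_isClosed_subset
      (isClosed_track p) ?_)
  rintro z (h | ⟨n, rfl⟩)
  · exact ⟨by simp [h], trivial⟩
  · exact ⟨⟨by positivity, inv_le_one_of_one_le₀ (by linarith [n.cast_nonneg (α := ℝ)])⟩, trivial⟩

lemma tendsto_dist_trackPt (hp : Tendsto (fun n => dist (p (n + 1)) (p n)) atTop (𝓝 0)) :
    Tendsto (fun n => dist (trackPt p (n + 1)) (trackPt p n)) atTop (𝓝 0) := by
  have hu : Tendsto (fun n : ℕ => ((n : ℝ) + 1)⁻¹) atTop (𝓝 0) := by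
    simpa only [one_div] using tendsto_one_div_add_atTop_nhds_zero_nat (𝕜 := ℝ)
  have h1 : Tendsto (fun n : ℕ => dist (((n + 1 : ℕ) : ℝ) + 1)⁻¹ ((n : ℝ) + 1)⁻¹) atTop (𝓝 0) := by
    simpa using ((tendsto_add_atTop_iff_nat 1).2 hu).dist hu
  have := h1.max hp
  rw [max_self] at this
  exact this

lemma tendsto_dist_trackPt_add
    (hp : Tendsto (fun n => dist (p (n + 1)) (p n)) atTop (𝓝 0)) (j : ℕ) :
    Tendsto (fun n => dist (trackPt p (n + j)) (trackPt p n)) atTop (𝓝 0) := by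
  induction j with
  | zero => simp
  | succ j ih =>
    have h := ((tendsto_add_atTop_iff_nat j).2 (tendsto_dist_trackPt hp)).add ih
    rw [add_zero] at h
    exact squeeze_zero (fun _ => dist_nonneg) (fun n => dist_triangle _ _ _) h

lemma tendsto_dist_iterate_advance
    (hp : Tendsto (fun n => dist (p (n + 1)) (p n)) atTop (𝓝 0)) (m n : ℕ) :
    Tendsto (fun k => dist ((advance p)^[k] (trackPt p m)) ((advance p)^[k] (trackPt p n)))
      atTop (𝓝 0) := by
  simp only [iterate_advance_trackPt]
  wlog h : n ≤ m generalizing m n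
  · simpa only [dist_comm] using this n m (le_of_not_ge h)
  obtain ⟨j, rfl⟩ := Nat.exists_eq_add_of_le h
  refine ((tendsto_dist_trackPt_add hp j).comp (tendsto_add_atTop_nat n)).congr fun k => ?_
  simp only [Function.comp_apply]
  congr 2 <;> omega

lemma continuous_advance (hp : Tendsto (fun n => dist (p (n + 1)) (p n)) atTop (𝓝 0)) :
    Continuous (advance p) := by
  have hfst : Continuous fun w : track p => w.1.1 := continuous_fst.comp continuous_subtype_val
  refine continuous_iff_continuousAt.2 fun z => ?_
  rcases track_cases z with hz | ⟨n, rfl⟩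
  · rw [Metric.continuousAt_iff']
    intro ε hε
    obtain ⟨N, hN⟩ :=
      eventually_atTop.1 ((tendsto_dist_trackPt hp).eventually_lt_const (half_pos hε))
    have hnear : ∀ᶠ w in 𝓝 z, w.1.1 < ((N : ℝ) + 1)⁻¹ :=
      hfst.continuousAt.eventually_lt_const (hz.trans_lt (by positivity))
    filter_upwards [hnear, Metric.ball_mem_nhds z (half_pos hε)] with w hw hwz
    rw [advance_of_fst_eq_zero hz]
    rw [Metric.mem_ball] at hwz
    rcases track_cases w with h0 | ⟨m, rfl⟩
    · rw [advance_of_fst_eq_zero h0]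
      linarith
    · rw [advance_trackPt]
      have := hN m (inv_natCast_add_one_lt_iff.1 hw).le
      linarith [dist_triangle (trackPt p (m + 1)) (trackPt p m) z]
  · have h1 : ∀ᶠ w in 𝓝 (trackPt p n), (((n + 1 : ℕ) : ℝ) + 1)⁻¹ < w.1.1 :=
      hfst.continuousAt.eventually_const_lt (inv_natCast_add_one_lt_iff.2 n.lt_succ_self)
    have h2 : (trackPt p '' Set.Iio n)ᶜ ∈ 𝓝 (trackPt p n) := by
      refine ((Set.finite_Iio n).image _).isClosed.isOpen_compl.mem_nhds ?_
      rintro ⟨m, hm, hmn⟩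
      exact (Set.mem_Iio.1 hm).ne (trackPt_injective p hmn)
    have h3 : ∀ᶠ w in 𝓝 (trackPt p n), w = trackPt p n := by
      filter_upwards [h1, h2] with w hw hw'
      rcases track_cases w with h0 | ⟨m, rfl⟩
      · rw [h0] at hw
        exact absurd hw (not_lt.2 (by positivity))
      · have hmn : m < n + 1 := inv_natCast_add_one_lt_iff.1 hw
        have : ¬ m < n := fun h => hw' ⟨m, h, rfl⟩
        rw [show m = n by omega]
    refine continuousAt_const.congr (h3.mono fun w hw => ?_) (f := fun _ => advance p (trackPt p n))
    rw [hw]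

end Track

/-! ### A slow curve -/

/-- A slowly growing phase. -/
noncomputable def slowPhase (n : ℕ) : ℝ := √(Real.log (n + 1))

/-- A slowly varying sequence in `(0, 3]` which is close to `0`, and also far from `0`, during
blocks of times of upper density one. -/
noncomputable def slowHeight (n : ℕ) : ℝ := ((n : ℝ) + 1)⁻¹ + (1 + Real.cos (slowPhase n))

/-- A slowly varying sequence in the unit circle with
`slowAngle (2 * n + 1) = - slowAngle n`. -/
noncomputable def slowAngle (n : ℕ) : Circle :=
  Circle.exp (Real.pi / Real.log 2 * Real.log (n + 1))

lemma slowHeight_pos (n : ℕ) : 0 < slowHeight n := by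
  have : 0 < ((n : ℝ) + 1)⁻¹ := by positivity
  unfold slowHeight
  linarith [Real.neg_one_le_cos (slowPhase n)]

lemma slowHeight_le (n : ℕ) : slowHeight n ≤ 3 := by
  have : ((n : ℝ) + 1)⁻¹ ≤ 1 := inv_le_one_of_one_le₀ (by linarith [n.cast_nonneg (α := ℝ)])
  unfold slowHeight
  linarith [Real.cos_le_one (slowPhase n)]

lemma tendsto_log_succ_sub_log :
    Tendsto (fun n : ℕ => Real.log (((n + 1 : ℕ) : ℝ) + 1) - Real.log ((n : ℝ) + 1))
      atTop (𝓝 0) := by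
  have h := (Real.tendsto_log_nat_add_one_sub_log).comp (tendsto_add_atTop_nat 1)
  refine h.congr fun n => ?_
  simp

lemma abs_sqrt_sub_sqrt_le (x y : ℝ) : |√x - √y| ≤ √|x - y| := by
  wlog h : y ≤ x generalizing x y
  · rw [abs_sub_comm, abs_sub_comm x]
    exact this y x (le_of_not_ge h)
  rw [abs_of_nonneg (sub_nonneg.2 (Real.sqrt_le_sqrt h)), abs_of_nonneg (sub_nonneg.2 h),
    sub_le_iff_le_add]
  rcases le_total y 0 with hy | hy
  · rw [Real.sqrt_eq_zero_of_nonpos hy, add_zero]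
    exact Real.sqrt_le_sqrt (by linarith)
  · refine Real.sqrt_le_iff.2 ⟨by positivity, ?_⟩
    nlinarith [Real.sq_sqrt hy, Real.sq_sqrt (sub_nonneg.2 h),
      mul_nonneg (Real.sqrt_nonneg (x - y)) (Real.sqrt_nonneg y)]

lemma tendsto_dist_slowHeight :
    Tendsto (fun n => dist (slowHeight (n + 1)) (slowHeight n)) atTop (𝓝 0) := by
  have hu : Tendsto (fun n : ℕ => ((n : ℝ) + 1)⁻¹) atTop (𝓝 0) := by
    simpa only [one_div] using tendsto_one_div_add_atTop_nhds_zero_nat (𝕜 := ℝ)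
  have h1 : Tendsto (fun n : ℕ => dist (((n + 1 : ℕ) : ℝ) + 1)⁻¹ ((n : ℝ) + 1)⁻¹) atTop (𝓝 0) := by
    simpa using ((tendsto_add_atTop_iff_nat 1).2 hu).dist hu
  have h2 := h1.add ((Real.continuous_sqrt.comp continuous_abs).continuousAt.tendsto.comp
    tendsto_log_succ_sub_log)
  simp only [Function.comp_apply, abs_zero, Real.sqrt_zero, add_zero] at h2
  refine squeeze_zero (fun _ => dist_nonneg) (fun n => ?_) h2
  refine (dist_add_add_le _ _ _ _).trans (add_le_add_right ?_ _)
  rw [dist_add_left, Real.dist_eq]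
  exact (Real.abs_cos_sub_cos_le _ _).trans (abs_sqrt_sub_sqrt_le _ _)

lemma Circle.dist_exp_le (x y : ℝ) : dist (Circle.exp x) (Circle.exp y) ≤ |x - y| := by
  change dist (Circle.exp x : ℂ) (Circle.exp y : ℂ) ≤ _
  rw [Circle.coe_exp, Circle.coe_exp, dist_eq_norm]
  have h : Complex.exp (x * Complex.I) - Complex.exp (y * Complex.I) =
      Complex.exp (y * Complex.I) * (Complex.exp (Complex.I * ((x - y : ℝ) : ℂ)) - 1) := by
    rw [mul_sub, ← Complex.exp_add, mul_one]
    congr 2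
    push_cast
    ring
  rw [h, norm_mul, Complex.norm_exp_ofReal_mul_I, one_mul]
  exact Real.norm_exp_I_mul_ofReal_sub_one_le

lemma tendsto_dist_slowAngle :
    Tendsto (fun n => dist (slowAngle (n + 1)) (slowAngle n)) atTop (𝓝 0) := by
  have h := (tendsto_log_succ_sub_log.const_mul (Real.pi / Real.log 2)).abs
  rw [mul_zero, abs_zero] at h
  refine squeeze_zero (fun _ => dist_nonneg) (fun n => ?_) h
  rw [mul_sub]
  exact Circle.dist_exp_le _ _

lemma dist_slowAngle_two_mul_add_one (n : ℕ) :
    dist (slowAngle (2 * n + 1)) (slowAngle n) = 2 := by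
  have h : ((slowAngle (2 * n + 1) : Circle) : ℂ) = - slowAngle n := by
    have hlog : Real.log (((2 * n + 1 : ℕ) : ℝ) + 1) = Real.log 2 + Real.log (n + 1) := by
      rw [← Real.log_mul two_ne_zero (by positivity)]
      push_cast
      ring_nf
    have h2 : Real.log 2 ≠ 0 := (Real.log_pos one_lt_two).ne'
    rw [slowAngle, slowAngle, hlog, mul_add, div_mul_cancel₀ _ h2, Circle.exp_add,
      Circle.coe_mul, Circle.coe_exp Real.pi, Complex.exp_pi_mul_I, neg_one_mul]
  change dist (slowAngle (2 * n + 1) : ℂ) (slowAngle n : ℂ) = 2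
  rw [h, dist_eq_norm, ← neg_add', norm_neg, ← two_mul, norm_mul,
    Circle.norm_coe, mul_one, Complex.norm_two]

lemma four_mul_card_slowAngle_le (a : Circle) (m : ℕ) :
    4 * ((Finset.range m).filter fun k => dist (slowAngle k) a < 1).card ≤ 3 * m + 1 := by
  set A := fun m => (Finset.range m).filter fun k => dist (slowAngle k) a < 1
  have h1 : (A m).card ≤ (A (m / 2)).card + (m - m / 2) := by
    have hsub : A m ⊆ A (m / 2) ∪ Finset.Ico (m / 2) m := by
      intro k hk
      simp only [A, Finset.mem_union, Finset.mem_filter, Finset.mem_range, Finset.mem_Ico] at hk ⊢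
      by_cases h : k < m / 2
      · exact Or.inl ⟨h, hk.2⟩
      · exact Or.inr ⟨not_lt.1 h, hk.1⟩
    refine (Finset.card_le_card hsub).trans ((Finset.card_union_le _ _).trans ?_)
    rw [Nat.card_Ico]
  have h2 : (A (m / 2)).card ≤
      ((Finset.range m).filter fun k => ¬ dist (slowAngle k) a < 1).card := by
    refine Finset.card_le_card_of_injOn (fun k => 2 * k + 1) (fun k hk => ?_)
      fun i _ j _ hij => by simpa using hij
    simp only [A, Finset.coe_filter, Finset.mem_range, Set.mem_ofPred_eq] at hk ⊢
    refine ⟨by omega, fun h => ?_⟩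
    have := dist_triangle_right (slowAngle (2 * k + 1)) (slowAngle k) a
    rw [dist_slowAngle_two_mul_add_one] at this
    linarith [hk.2]
  have h3 := Finset.card_filter_add_card_filter_not (s := Finset.range m)
    fun k => dist (slowAngle k) a < 1
  rw [Finset.card_range] at h3
  change 4 * (A m).card ≤ _
  change (A m).card + _ = m at h3
  omega

lemma eventually_card_slowAngle_le (a : Circle) (n : ℕ) :
    ∀ᶠ m : ℕ in atTop,
      (((Finset.Ioo 0 m).filter fun k => dist (slowAngle (n + k)) a < 1).card : ℝ) ≤
        7 / 8 * m := by
  filter_upwards [eventually_ge_atTop (6 * n + 2)] with m hm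
  have h1 : ((Finset.Ioo 0 m).filter fun k => dist (slowAngle (n + k)) a < 1).card ≤
      ((Finset.range (n + m)).filter fun k => dist (slowAngle k) a < 1).card := by
    refine Finset.card_le_card_of_injOn (fun k => n + k) (fun k hk => ?_)
      fun i _ j _ hij => by simpa using hij
    simp only [Finset.coe_filter, Finset.mem_Ioo, Finset.mem_range, Set.mem_ofPred_eq] at hk ⊢
    exact ⟨by omega, hk.2⟩
  have h2 := four_mul_card_slowAngle_le a (n + m)
  have h3 : 8 * ((Finset.Ioo 0 m).filter fun k => dist (slowAngle (n + k)) a < 1).card ≤ 7 * m := by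
    omega
  have h4 : (8 : ℝ) * ((Finset.Ioo 0 m).filter fun k => dist (slowAngle (n + k)) a < 1).card ≤
      7 * m := by exact_mod_cast h3
  linarith

lemma eventually_exists_slowPhase_block {ε η : ℝ} (hε : 0 < ε) (hη : 0 < η) (M : ℕ) :
    ∀ᶠ α : ℝ in atTop, ∃ m ≥ M,
      (((Finset.Ioo 0 m).filter fun k =>
        ¬ (slowPhase k ∈ Set.Icc α (α + ε) ∧ α ≤ k + 1)).card : ℝ) ≤ η * m := by
  filter_upwards [eventually_ge_atTop 1, eventually_ge_atTop (M : ℝ),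
    eventually_ge_atTop (2 * ε * η)⁻¹] with α h1 hM hαη
  refine ⟨⌊Real.exp ((α + ε) ^ 2)⌋₊, Nat.le_floor ?_, ?_⟩
  · nlinarith [Real.add_one_le_exp ((α + ε) ^ 2)]
  have hsub : ((Finset.Ioo 0 ⌊Real.exp ((α + ε) ^ 2)⌋₊).filter fun k : ℕ =>
      ¬ (slowPhase k ∈ Set.Icc α (α + ε) ∧ α ≤ k + 1)) ⊆
      Finset.range ⌊Real.exp (α ^ 2)⌋₊ := by
    intro k hk
    rw [Finset.mem_filter, Finset.mem_Ioo] at hk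
    rw [Finset.mem_range]
    by_contra hlt
    have hk1 : Real.exp (α ^ 2) < k + 1 := (Nat.lt_floor_add_one _).trans_le
      (add_le_add_left (Nat.cast_le.2 (not_lt.1 hlt)) 1)
    have hk2 : (k : ℝ) + 1 ≤ Real.exp ((α + ε) ^ 2) := by
      exact_mod_cast (Nat.le_floor_iff (Real.exp_pos _).le).1 (Nat.succ_le_of_lt hk.1.2)
    have hk0 : (0 : ℝ) < k + 1 := by positivity
    refine hk.2 ⟨⟨?_, ?_⟩, ?_⟩
    · exact Real.le_sqrt_of_sq_le ((Real.le_log_iff_exp_le hk0).2 hk1.le)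
    · exact Real.sqrt_le_iff.2 ⟨by linarith, (Real.log_le_iff_le_exp hk0).2 hk2⟩
    · nlinarith [Real.add_one_le_exp (α ^ 2)]
  have hcard := Finset.card_le_card hsub
  rw [Finset.card_range] at hcard
  have hfloor := Nat.lt_floor_add_one (Real.exp ((α + ε) ^ 2))
  have hratio : Real.exp (α ^ 2) ≤ η * (Real.exp ((α + ε) ^ 2) - 1) := by
    have e1 : 1 ≤ Real.exp (α ^ 2) := Real.one_le_exp (sq_nonneg α)
    have e2 : Real.exp (α ^ 2) * Real.exp (2 * α * ε) ≤ Real.exp ((α + ε) ^ 2) := by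
      rw [← Real.exp_add]
      exact Real.exp_le_exp.2 (by nlinarith)
    have e3 : 2 * α * ε + 1 ≤ Real.exp (2 * α * ε) := Real.add_one_le_exp _
    have e4 : 1 ≤ η * (2 * α * ε) := by
      rw [inv_le_iff_one_le_mul₀ (by positivity)] at hαη
      linarith
    have e5 : Real.exp (α ^ 2) * (2 * α * ε + 1) ≤ Real.exp ((α + ε) ^ 2) :=
      (mul_le_mul_of_nonneg_left e3 (by positivity)).trans e2
    have e6 : Real.exp (α ^ 2) * 1 ≤ Real.exp (α ^ 2) * (η * (2 * α * ε)) :=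
      mul_le_mul_of_nonneg_left e4 (by positivity)
    nlinarith
  calc _ ≤ (⌊Real.exp (α ^ 2)⌋₊ : ℝ) := Nat.cast_le.2 hcard
    _ ≤ Real.exp (α ^ 2) := Nat.floor_le (Real.exp_pos _).le
    _ ≤ η * (Real.exp ((α + ε) ^ 2) - 1) := hratio
    _ ≤ _ := mul_le_mul_of_nonneg_left (by linarith) hη.le

lemma frequently_card_slowHeight_le (φ : ℝ) {ε η : ℝ} (hε : 0 < ε) (hη : 0 < η) :
    ∃ᶠ m : ℕ in atTop,
      (((Finset.Ioo 0 m).filter fun k =>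
        ¬ |slowHeight k - (1 + Real.cos φ)| < ε).card : ℝ) ≤ η * m := by
  refine frequently_atTop.2 fun M => ?_
  have hα : Tendsto (fun j : ℕ => φ + j * (2 * Real.pi)) atTop atTop :=
    tendsto_atTop_add_const_left _ _
      (tendsto_natCast_atTop_atTop.atTop_mul_const Real.two_pi_pos)
  have hε' : 0 < ε / 3 := by positivity
  obtain ⟨j, ⟨m, hm, hcard⟩, hj⟩ := ((hα.eventually
    (eventually_exists_slowPhase_block hε' hη M)).and
      (hα.eventually_ge_atTop (ε / 3)⁻¹)).exists
  refine ⟨m, hm, le_trans (Nat.cast_le.2 (Finset.card_le_card ?_)) hcard⟩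
  refine Finset.monotone_filter_right _ fun k _ hk hblock => hk ?_
  obtain ⟨⟨h1, h2⟩, h3⟩ := hblock
  have hcos := Real.abs_cos_sub_cos_le (slowPhase k) (φ + j * (2 * Real.pi))
  rw [Real.cos_add_nat_mul_two_pi, abs_of_nonneg (sub_nonneg.2 h1)] at hcos
  have hu : ((k : ℝ) + 1)⁻¹ ≤ ε / 3 := inv_le_of_inv_le₀ hε' (hj.trans h3)
  have hu0 : 0 < ((k : ℝ) + 1)⁻¹ := by positivity
  rw [abs_le] at hcos
  rw [abs_lt, slowHeight]
  constructor <;> linarith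

/-! ### The extension and its factor -/

/-- The pair of slow sequences, as a sequence in a compact space. -/
noncomputable def slowCurve (n : ℕ) : Set.Icc (0 : ℝ) 3 × Circle :=
  (⟨slowHeight n, (slowHeight_pos n).le, slowHeight_le n⟩, slowAngle n)

lemma tendsto_dist_slowCurve :
    Tendsto (fun n => dist (slowCurve (n + 1)) (slowCurve n)) atTop (𝓝 0) := by
  have h := tendsto_dist_slowHeight.max tendsto_dist_slowAngle
  rw [max_self] at h
  exact h

/-- The space of the extension. -/
abbrev SlowSpace : Type := track slowCurve × Set.Icc (0 : ℝ) 1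

/-- The map of the extension. -/
noncomputable def slowMap : SlowSpace → SlowSpace := Prod.map (advance slowCurve) id

lemma continuous_slowMap : Continuous slowMap :=
  (continuous_advance tendsto_dist_slowCurve).prodMap continuous_id

lemma iterate_slowMap (k : ℕ) (x : SlowSpace) :
    slowMap^[k] x = ((advance slowCurve)^[k] x.1, x.2) := by
  rw [slowMap, Prod.map_iterate, Function.iterate_id]
  rfl

lemma upperDF_slowMap_lt_one_of_fst_eq_zero {z : track slowCurve} (hz : z.1.1 = 0) (n : ℕ)
    (c d : Set.Icc (0 : ℝ) 1) : upperDF slowMap (trackPt slowCurve n, c) (z, d) 1 < 1 := by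
  refine lt_of_le_of_lt (upperDF_le_of_eventually (a := 7 / 8) (by norm_num) ?_) (by norm_num)
  filter_upwards [eventually_card_slowAngle_le z.1.2.2 n] with m hm
  refine le_trans (Nat.cast_le.2 (Finset.card_le_card ?_)) hm
  refine Finset.monotone_filter_right _ fun k _ hk => lt_of_le_of_lt ?_ hk
  rw [iterate_slowMap, iterate_slowMap, iterate_advance_trackPt, iterate_advance_of_fst_eq_zero hz]
  exact (le_max_right _ _).trans ((le_max_right _ _).trans (le_max_left _ _))

lemma upperDF_comm {X : Type*} [MetricSpace X] (f : X → X) (x y : X) (δ : ℝ) :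
    upperDF f x y δ = upperDF f y x δ := by
  simp only [upperDF, dist_comm]

lemma not_distScrambled2_slowMap {x y : SlowSpace} (hxy : x ≠ y) :
    ¬ DistScrambled2 slowMap x y := by
  obtain ⟨z, c⟩ := x
  obtain ⟨w, d⟩ := y
  by_cases hcd : c = d
  · subst hcd
    rcases track_cases z with hz | ⟨m, rfl⟩ <;> rcases track_cases w with hw | ⟨n, rfl⟩
    · refine not_distScrambled2_of_upperDF_lt_one (dist_pos.2 hxy)
        ((upperDF_le_zero_of_forall_le fun k => ?_).trans_lt one_pos)
      simp only [iterate_slowMap, iterate_advance_of_fst_eq_zero hz,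
        iterate_advance_of_fst_eq_zero hw, le_refl]
    · refine not_distScrambled2_of_upperDF_lt_one one_pos ?_
      rw [upperDF_comm]
      exact upperDF_slowMap_lt_one_of_fst_eq_zero hz n c c
    · exact not_distScrambled2_of_upperDF_lt_one one_pos
        (upperDF_slowMap_lt_one_of_fst_eq_zero hw m c c)
    · refine not_distScrambled2_of_tendsto
        ((tendsto_dist_iterate_advance tendsto_dist_slowCurve m n).congr fun k => ?_)
      simp [iterate_slowMap, Prod.dist_eq]
  · refine not_distScrambled2_of_upperDF_lt_one (dist_pos.2 hcd)
      ((upperDF_le_zero_of_forall_le fun k => ?_).trans_lt one_pos)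
    rw [iterate_slowMap, iterate_slowMap]
    exact le_max_right _ _

/-- The map collapsing the angle, and scaling the last coordinate by the height. -/
def collapse (x : SlowSpace) : ℝ × ℝ := (x.1.1.1, x.1.1.2.1 * x.2)

lemma continuous_collapse : Continuous collapse := by
  unfold collapse
  fun_prop

/-- The space of the factor. -/
abbrev CollapsedSpace : Type := Set.range collapse

lemma rangeFactorization_slowMap_factorsThrough :
    Function.FactorsThrough (Set.rangeFactorization collapse ∘ slowMap)
      (Set.rangeFactorization collapse) := by
  rintro ⟨z, c⟩ ⟨w, d⟩ h
  have h1 : collapse (z, c) = collapse (w, d) := congrArg Subtype.val h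
  obtain ⟨hfst, hsnd⟩ := Prod.ext_iff.1 h1
  change z.1.1 = w.1.1 at hfst
  rcases track_cases z with hz | ⟨n, rfl⟩
  · have hz' : slowMap (z, c) = (z, c) := Prod.ext (advance_of_fst_eq_zero hz) rfl
    have hw' : slowMap (w, d) = (w, d) := Prod.ext (advance_of_fst_eq_zero (hfst ▸ hz)) rfl
    simp only [Function.comp_apply, hz', hw', h]
  · rcases track_cases w with hw | ⟨m, rfl⟩
    · exact absurd (hfst.trans hw) (trackPt_fst_pos _ n).ne'
    · obtain rfl : n = m := by
        change ((n : ℝ) + 1)⁻¹ = ((m : ℝ) + 1)⁻¹ at hfst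
        exact_mod_cast add_right_cancel (inv_injective hfst)
      change slowHeight n * (c : ℝ) = slowHeight n * (d : ℝ) at hsnd
      rw [Subtype.ext (mul_left_cancel₀ (slowHeight_pos n).ne' hsnd)]

/-- The map of the factor. -/
noncomputable def collapsedMap : CollapsedSpace → CollapsedSpace :=
  Function.extend (Set.rangeFactorization collapse) (Set.rangeFactorization collapse ∘ slowMap) id

lemma rangeFactorization_comp_slowMap :
    Set.rangeFactorization collapse ∘ slowMap = collapsedMap ∘ Set.rangeFactorization collapse :=
  (rangeFactorization_slowMap_factorsThrough.extend_comp _).symm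

lemma continuous_rangeFactorization_collapse : Continuous (Set.rangeFactorization collapse) :=
  continuous_collapse.subtype_mk _

lemma continuous_collapsedMap : Continuous collapsedMap := by
  have hq := continuous_rangeFactorization_collapse.isClosedMap.isQuotientMap
    continuous_rangeFactorization_collapse Set.rangeFactorization_surjective
  rw [hq.continuous_iff, ← rangeFactorization_comp_slowMap]
  exact continuous_rangeFactorization_collapse.comp continuous_slowMap

/-- The points of the distributionally scrambled set. -/
noncomputable def scrambledPt (c : Set.Icc (0 : ℝ) 1) : CollapsedSpace :=
  Set.rangeFactorization collapse (trackPt slowCurve 0, c)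

lemma dist_iterate_scrambledPt (c d : Set.Icc (0 : ℝ) 1) (k : ℕ) :
    dist (collapsedMap^[k] (scrambledPt c)) (collapsedMap^[k] (scrambledPt d)) =
      slowHeight k * dist c d := by
  have h : ∀ c, collapsedMap^[k] (scrambledPt c) =
      Set.rangeFactorization collapse (trackPt slowCurve k, c) := fun c => by
    have hsemi : Function.Semiconj (Set.rangeFactorization collapse) slowMap collapsedMap :=
      fun x => congrFun rangeFactorization_comp_slowMap x
    rw [scrambledPt, ← (hsemi.iterate_right k).eq, iterate_slowMap, iterate_advance_trackPt,
      Nat.zero_add]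
  rw [h, h, Subtype.dist_eq, Prod.dist_eq]
  change max (dist ((k : ℝ) + 1)⁻¹ ((k : ℝ) + 1)⁻¹)
    (dist (slowHeight k * (c : ℝ)) (slowHeight k * (d : ℝ))) = _
  rw [dist_self, max_eq_right dist_nonneg, Real.dist_eq, ← mul_sub, abs_mul,
    abs_of_pos (slowHeight_pos k), Subtype.dist_eq, Real.dist_eq]

lemma scrambledPt_injective : Function.Injective scrambledPt := by
  intro c d h
  have h1 := dist_iterate_scrambledPt c d 0
  rw [h, dist_self] at h1
  exact dist_eq_zero.1 ((mul_eq_zero.1 h1.symm).resolve_left (slowHeight_pos 0).ne')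

instance compactSpace_collapsedSpace : CompactSpace CollapsedSpace :=
  isCompact_iff_compactSpace.1 (isCompact_range continuous_collapse)

lemma distScrambled1_scrambledPt {c d : Set.Icc (0 : ℝ) 1} (hcd : c ≠ d) :
    DistScrambled1 collapsedMap (scrambledPt c) (scrambledPt d) := by
  have hpos : 0 < dist c d := dist_pos.2 hcd
  refine ⟨scrambledPt_injective.ne hcd, fun δ hδ => ?_, dist c d, hpos, ?_, ?_⟩
  · refine upperDF_eq_one_of_frequently fun η hη => ?_
    refine (frequently_card_slowHeight_le Real.pi (div_pos hδ hpos) hη).mono fun m hm =>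
      le_trans (Nat.cast_le.2 (Finset.card_le_card ?_)) hm
    refine Finset.monotone_filter_right _ fun k _ hk hlt => hk ?_
    rw [Real.cos_pi, add_neg_cancel, sub_zero, abs_of_pos (slowHeight_pos k),
      lt_div_iff₀ hpos] at hlt
    rwa [dist_iterate_scrambledPt]
  · refine le_trans ?_ (dist_le_diam_of_mem isCompact_univ.isBounded
      (Set.mem_univ (scrambledPt c)) (Set.mem_univ (scrambledPt d)))
    have h0 := dist_iterate_scrambledPt c d 0
    rw [Function.iterate_zero, id, id] at h0
    rw [h0]
    refine le_mul_of_one_le_left hpos.le ?_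
    norm_num [slowHeight, slowPhase]
  · refine lowerDF_eq_zero_of_frequently fun η hη => ?_
    refine (frequently_card_slowHeight_le 0 one_pos hη).mono fun m hm =>
      le_trans (Nat.cast_le.2 (Finset.card_le_card ?_)) hm
    refine Finset.monotone_filter_right _ fun k _ hk hlt => ?_
    rw [dist_iterate_scrambledPt] at hk
    rw [Real.cos_zero, abs_lt] at hlt
    nlinarith

lemma not_countable_range_scrambledPt : ¬ (Set.range scrambledPt).Countable := by
  intro h
  have h1 : (Set.univ : Set (Set.Icc (0 : ℝ) 1)).Countable :=
    (Set.countable_of_injective_of_countable_image scrambledPt_injective.injOn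
      (by rwa [Set.image_univ]))
  exact (Cardinal.Real.Icc_countable_iff.1 (Set.countable_coe_iff.1
    (Set.countable_univ_iff.1 h1))).not_gt one_pos

/-- There exists a DC1 system `(Y, f)` that is a factor (via a semiconjugacy `π`)
of a system `(X, F)` possessing no distributionally scrambled pair of type 2
(hence none of type 1). -/
theorem stmt0 :
    ∃ (X Y : Type) (_ : MetricSpace X) (_ : MetricSpace Y)
      (_ : CompactSpace X) (_ : CompactSpace Y)
      (F : X → X) (f : Y → Y) (π : X → Y),
      Continuous F ∧ Continuous f ∧ Continuous π ∧ Function.Surjective π ∧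
      π ∘ F = f ∘ π ∧
      (∃ S : Set Y, ¬ S.Countable ∧
        ∀ u ∈ S, ∀ v ∈ S, u ≠ v → DistScrambled1 f u v) ∧
      (∀ u v : X, u ≠ v → ¬ DistScrambled2 F u v) ∧
      (∀ u v : X, u ≠ v → ¬ DistScrambled1 F u v) := by
  refine ⟨SlowSpace, CollapsedSpace, inferInstance, inferInstance, inferInstance, inferInstance,
    slowMap, collapsedMap, Set.rangeFactorization collapse, continuous_slowMap,
    continuous_collapsedMap, continuous_rangeFactorization_collapse,
    Set.rangeFactorization_surjective, rangeFactorization_comp_slowMap,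
    ⟨Set.range scrambledPt, not_countable_range_scrambledPt, ?_⟩,
    fun _ _ h => not_distScrambled2_slowMap h,
    fun _ _ h h1 => not_distScrambled2_slowMap h h1.distScrambled2⟩
  rintro _ ⟨c, rfl⟩ _ ⟨d, rfl⟩ hne
  exact distScrambled1_scrambledPt (ne_of_apply_ne _ hne)
end

section
/- There exist compact metric spaces (X,d_X) and (Y,d_Y), continuous maps F: X → X and f: Y → Y, and a continuous surjection π: X → Y satisfying π ∘ F = f ∘ π, such that (Y,f) has an uncountable set S whose distinct pairs are all distributionally scrambled of type 1, while in (X,F) every pair of distinct points u,v ∈ X satisfies Φ*_{(u,v)}(δ) < 1 for some δ > 0. -/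
open Filter Metric
open scoped Classical

/-- The time coordinate of the `n`-th point of the transient orbit. -/
noncomputable def invSucc (n : ℕ) : ℝ := 1 / ((n : ℝ) + 1)

lemma invSucc_pos (n : ℕ) : 0 < invSucc n := by unfold invSucc; positivity

lemma invSucc_strictAnti : StrictAnti invSucc := by
  intro m n h
  have : (m : ℝ) < n := by exact_mod_cast h
  unfold invSucc
  gcongr

lemma invSucc_le_one (n : ℕ) : invSucc n ≤ 1 := by
  have := invSucc_strictAnti.antitone (Nat.zero_le n)
  simpa [invSucc] using this

lemma tendsto_invSucc : Tendsto invSucc atTop (nhds 0) :=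
  tendsto_one_div_add_atTop_nhds_zero_nat

/-- The space `K` together with a discrete orbit whose `n`-th point lies at height
`1 / (n + 1)` above the point `c n` of `K`. -/
inductive OrbitExt {K : Type} (c : ℕ → K) : Type
  | limit (k : K)
  | orbit (n : ℕ)

namespace OrbitExt

variable {K : Type} {c : ℕ → K}

/-- The height over `K`. -/
noncomputable def height : OrbitExt c → ℝ
  | limit _ => 0
  | orbit n => invSucc n

/-- The projection to `K`. -/
def base : OrbitExt c → K
  | limit k => k
  | orbit n => c n

/-- The map moving the orbit forward and acting by `G` on `K`. -/
def shift (G : K → K) : OrbitExt c → OrbitExt c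
  | limit k => limit (G k)
  | orbit n => orbit (n + 1)

/-- The embedding into `ℝ × K` by height and base point. -/
noncomputable def embed (x : OrbitExt c) : ℝ × K := (x.height, x.base)

lemma embed_injective : Function.Injective (embed (c := c)) := by
  rintro (k | n) (l | m) h <;> simp only [embed, height, base, Prod.mk.injEq] at h
  · rw [h.2]
  · exact absurd h.1 (invSucc_pos m).ne
  · exact absurd h.1 (invSucc_pos n).ne'
  · rw [invSucc_strictAnti.injective h.1]

lemma shift_iterate_orbit (G : K → K) (n k : ℕ) :
    (shift (c := c) G)^[k] (orbit n) = orbit (n + k) := by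
  induction k with
  | zero => rfl
  | succ k ih => rw [Function.iterate_succ_apply', ih]; rfl

lemma shift_iterate_limit (G : K → K) (x : K) (k : ℕ) :
    (shift (c := c) G)^[k] (limit x) = limit (G^[k] x) := by
  induction k with
  | zero => rfl
  | succ k ih => rw [Function.iterate_succ_apply', ih, Function.iterate_succ_apply']; rfl

lemma range_embed : Set.range (embed (c := c)) =
    ⋂ N : ℕ, ({p : ℝ × K | 0 ≤ p.1 ∧ p.1 ≤ invSucc N} ∪
      (fun n => (invSucc n, c n)) '' Set.Iio N) := by
  ext ⟨t, k⟩
  simp only [Set.mem_range, Set.mem_iInter, Set.mem_union, Set.mem_ofPred_eq, Set.mem_image,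
    Set.mem_Iio]
  constructor
  · rintro ⟨l | n, h⟩ N
    · left
      simp only [embed, height, base, Prod.mk.injEq] at h
      rw [← h.1]
      exact ⟨le_rfl, (invSucc_pos N).le⟩
    · rcases lt_or_ge n N with hn | hn
      · exact Or.inr ⟨n, hn, h⟩
      · left
        simp only [embed, height, base, Prod.mk.injEq] at h
        rw [← h.1]
        exact ⟨(invSucc_pos n).le, invSucc_strictAnti.antitone hn⟩
  · intro h
    by_cases ht : t = 0
    · exact ⟨limit k, by simp [embed, height, base, ht]⟩
    · have ht0 : 0 < t := by
        rcases h 0 with h0 | ⟨n, hn, -⟩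
        · exact lt_of_le_of_ne h0.1 (Ne.symm ht)
        · omega
      obtain ⟨N, hN⟩ := (tendsto_invSucc.eventually (gt_mem_nhds ht0)).exists
      rcases h N with h0 | ⟨n, -, hn⟩
      · exact absurd h0.2 (not_le.2 hN)
      · exact ⟨orbit n, hn⟩

variable [MetricSpace K]

noncomputable instance : MetricSpace (OrbitExt c) :=
  MetricSpace.induced embed embed_injective inferInstance

lemma dist_eq_max (x y : OrbitExt c) :
    dist x y = max |x.height - y.height| (dist x.base y.base) := rfl

lemma isometry_embed : Isometry (embed (c := c)) := Isometry.of_dist_eq fun _ _ => rfl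

lemma continuous_height : Continuous (height (c := c)) :=
  continuous_fst.comp isometry_embed.continuous

lemma continuous_base : Continuous (base (c := c)) :=
  continuous_snd.comp isometry_embed.continuous

lemma dist_base_le (x y : OrbitExt c) : dist x.base y.base ≤ dist x y :=
  le_max_right _ _

instance [CompactSpace K] : CompactSpace (OrbitExt c) := by
  have hcl : IsClosed (Set.range (embed (c := c))) := by
    rw [range_embed]
    refine isClosed_iInter fun N => IsClosed.union ?_ ((Set.finite_Iio N).image _).isClosed
    exact (isClosed_le continuous_const continuous_fst).inter
      (isClosed_le continuous_fst continuous_const)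
  have hsub : Set.range (embed (c := c)) ⊆ Set.Icc (0 : ℝ) 1 ×ˢ (Set.univ : Set K) := by
    rintro _ ⟨k | n, rfl⟩
    · exact ⟨⟨le_rfl, zero_le_one⟩, trivial⟩
    · exact ⟨⟨(invSucc_pos n).le, invSucc_le_one n⟩, trivial⟩
  have hK := (isCompact_Icc.prod isCompact_univ).of_isClosed_subset hcl hsub
  rw [← Set.image_univ] at hK
  exact ⟨isometry_embed.isEmbedding.isInducing.isCompact_iff.2 hK⟩

lemma eq_orbit_of_dist_lt {n : ℕ} {y : OrbitExt c}
    (h : dist y (orbit n) < invSucc n - invSucc (n + 1)) : y = orbit n := by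
  have h1 : |y.height - invSucc n| < invSucc n - invSucc (n + 1) :=
    lt_of_le_of_lt (le_max_left _ _) h
  rw [abs_lt] at h1
  rcases y with k | m
  · have : height (limit k : OrbitExt c) = 0 := rfl
    have := invSucc_pos (n + 1)
    linarith
  · have hm : height (orbit m : OrbitExt c) = invSucc m := rfl
    rw [hm] at h1
    rcases lt_trichotomy m n with hmn | rfl | hmn
    · exfalso
      obtain ⟨j, rfl⟩ : ∃ j, n = j + 1 := ⟨n - 1, by omega⟩
      have h2 := invSucc_strictAnti.antitone (show m ≤ j by omega)
      have h3 : invSucc (j + 1) - invSucc (j + 1 + 1) < invSucc j - invSucc (j + 1) := by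
        unfold invSucc
        push_cast
        rw [div_sub_div _ _ (by positivity) (by positivity),
          div_sub_div _ _ (by positivity) (by positivity), div_lt_div_iff₀ (by positivity)
          (by positivity)]
        nlinarith [(Nat.cast_nonneg j : (0 : ℝ) ≤ j)]
      linarith
    · rfl
    · exfalso
      have := invSucc_strictAnti.antitone (show n + 1 ≤ m by omega)
      linarith

lemma continuous_shift {G : K → K} (hG : Isometry G)
    (hc : ∀ n, dist (c (n + 1)) (G (c n)) ≤ invSucc n) :
    Continuous (shift (c := c) G) := by
  have hheight : ∀ x : OrbitExt c, 0 ≤ x.height := by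
    rintro (k | n)
    · exact le_rfl
    · exact (invSucc_pos n).le
  have hle : ∀ x : OrbitExt c, (shift G x).height ≤ x.height := by
    rintro (k | n)
    · exact le_rfl
    · exact invSucc_strictAnti.antitone (Nat.le_succ n)
  have hbase : ∀ x : OrbitExt c, dist (shift G x).base (G x.base) ≤ x.height := by
    rintro (k | n)
    · exact (dist_self _).le
    · exact hc n
  rw [Metric.continuous_iff]
  rintro (k | n) ε hε
  · refine ⟨ε / 2, by positivity, fun y hy => ?_⟩
    have h1 : y.height ≤ dist y (limit k) := by
      refine le_trans ?_ (le_max_left _ _)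
      simpa [embed, height] using le_abs_self y.height
    have h2 : dist y.base k ≤ dist y (limit k) := dist_base_le y (limit k)
    rw [dist_eq_max]
    refine max_lt ?_ ?_
    · have h3 := hle y
      have h4 : |(shift G y).height - 0| = (shift G y).height := by
        rw [sub_zero, abs_of_nonneg (hheight _)]
      change |(shift G y).height - 0| < ε
      linarith
    · have h3 := dist_triangle (shift G y).base (G y.base) (G k)
      rw [hG.dist_eq] at h3
      have h4 := hbase y
      change dist (shift G y).base (G k) < ε
      linarith
  · refine ⟨invSucc n - invSucc (n + 1),
      sub_pos.2 (invSucc_strictAnti (Nat.lt_succ_self n)), fun y hy => ?_⟩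
    rw [eq_orbit_of_dist_lt hy, dist_self]
    exact hε

end OrbitExt

section Frequency

variable {D : ℕ → ℝ} {δ : ℝ}

/-- The frequency of the times `0 < k < m` with `D k < δ`. -/
noncomputable def freqBelow (D : ℕ → ℝ) (δ : ℝ) (m : ℕ) : ℝ :=
  (((Finset.Ioo 0 m).filter fun k => D k < δ).card : ℝ) / m

lemma freqBelow_nonneg (m : ℕ) : 0 ≤ freqBelow D δ m := by unfold freqBelow; positivity

lemma freqBelow_le_one (m : ℕ) : freqBelow D δ m ≤ 1 := by
  refine div_le_one_of_le₀ ?_ (Nat.cast_nonneg m)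
  have := (Finset.card_filter_le (Finset.Ioo 0 m) fun k => D k < δ)
  rw [Nat.card_Ioo] at this
  exact_mod_cast this.trans (by omega)

lemma isBoundedUnder_le_freqBelow :
    IsBoundedUnder (· ≤ ·) atTop (freqBelow D δ) :=
  isBoundedUnder_of ⟨1, freqBelow_le_one⟩

lemma isBoundedUnder_ge_freqBelow :
    IsBoundedUnder (· ≥ ·) atTop (freqBelow D δ) :=
  isBoundedUnder_of ⟨0, freqBelow_nonneg⟩

lemma limsup_freqBelow_lt_one {κ : ℝ} (hκ : 0 < κ)
    (h : ∀ᶠ m : ℕ in atTop, ∃ p q : ℕ, 0 < p ∧ q ≤ m ∧ κ * m ≤ (q : ℝ) - p ∧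
      ∀ k, p ≤ k → k < q → δ ≤ D k) :
    limsup (freqBelow D δ) atTop < 1 := by
  refine lt_of_le_of_lt (limsup_le_of_le (a := 1 - κ)
    isBoundedUnder_ge_freqBelow.isCoboundedUnder_le ?_) (by linarith)
  filter_upwards [h, eventually_gt_atTop 0] with m ⟨p, q, hp, hq, hpq, hk⟩ hm
  have hm' : (0 : ℝ) < m := by exact_mod_cast hm
  unfold freqBelow
  rw [div_le_iff₀ hm']
  have hpq' : p ≤ q := by
    have : (p : ℝ) ≤ q := by nlinarith
    exact_mod_cast this
  have hsub : ((Finset.Ioo 0 m).filter fun k => D k < δ) ⊆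
      Finset.Ioo 0 m \ Finset.Ico p q := by
    intro k
    simp only [Finset.mem_filter, Finset.mem_sdiff, Finset.mem_Ico, not_and]
    exact fun ⟨h1, h2⟩ => ⟨h1, fun h3 h4 => absurd (hk k h3 h4) (not_le.2 h2)⟩
  have h1 := Finset.card_le_card hsub
  rw [Finset.card_sdiff_of_subset, Nat.card_Ioo, Nat.card_Ico] at h1
  · have h2 : ((Finset.Ioo 0 m).filter fun k => D k < δ).card + q ≤ m + p := by omega
    have h3 : (((Finset.Ioo 0 m).filter fun k => D k < δ).card : ℝ) + q ≤ m + p := by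
      exact_mod_cast h2
    linarith
  · intro k
    simp only [Finset.mem_Ico, Finset.mem_Ioo]
    omega

lemma limsup_freqBelow_lt_one_of_forall_le (h : ∀ k, δ ≤ D k) :
    limsup (freqBelow D δ) atTop < 1 := by
  refine limsup_freqBelow_lt_one (κ := 1 / 2) (by norm_num) ?_
  filter_upwards [eventually_ge_atTop 2] with m hm
  refine ⟨1, m, one_pos, le_rfl, ?_, fun k _ _ => h k⟩
  have : (2 : ℝ) ≤ m := by exact_mod_cast hm
  push_cast
  linarith

lemma le_freqBelow {ε : ℝ} (hε : 0 < ε) {m : ℕ} (hm : 2 / ε ≤ m)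
    (h : ∀ k : ℕ, ε / 2 * m ≤ k → k < m → D k < δ) : 1 - ε ≤ freqBelow D δ m := by
  have hm' : (0 : ℝ) < m := lt_of_lt_of_le (by positivity) hm
  rw [div_le_iff₀ hε] at hm
  unfold freqBelow
  rw [le_div_iff₀ hm']
  set p := ⌈ε / 2 * m⌉₊ with hp
  have hp0 : 0 < p := Nat.ceil_pos.2 (by positivity)
  have hp1 : (p : ℝ) < ε / 2 * m + 1 := Nat.ceil_lt_add_one (by positivity)
  have hsub : Finset.Ico p m ⊆ (Finset.Ioo 0 m).filter fun k => D k < δ := by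
    intro k
    simp only [Finset.mem_filter, Finset.mem_Ico, Finset.mem_Ioo]
    exact fun ⟨h1, h2⟩ => ⟨⟨by omega, h2⟩, h k (Nat.ceil_le.1 h1) h2⟩
  have h1 := Finset.card_le_card hsub
  rw [Nat.card_Ico, Nat.sub_le_iff_le_add] at h1
  have h2 : (m : ℝ) ≤ ((Finset.Ioo 0 m).filter fun k => D k < δ).card + p := by
    exact_mod_cast h1
  linarith

lemma freqBelow_le {ε : ℝ} (hε : 0 < ε) {m : ℕ} (hm : 2 / ε ≤ m)
    (h : ∀ k : ℕ, ε / 2 * m ≤ k → k < m → δ ≤ D k) : freqBelow D δ m ≤ ε := by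
  have hm' : (0 : ℝ) < m := lt_of_lt_of_le (by positivity) hm
  rw [div_le_iff₀ hε] at hm
  unfold freqBelow
  rw [div_le_iff₀ hm']
  have hsub : ((Finset.Ioo 0 m).filter fun k => D k < δ) ⊆
      Finset.range ⌈ε / 2 * m⌉₊ := by
    intro k
    simp only [Finset.mem_filter, Finset.mem_range, Finset.mem_Ioo]
    rintro ⟨⟨-, h1⟩, h2⟩
    by_contra h3
    exact absurd (h k (Nat.ceil_le.1 (not_lt.1 h3)) h1) (not_le.2 h2)
  have h1 := Finset.card_le_card hsub
  rw [Finset.card_range] at h1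
  have h2 : (((Finset.Ioo 0 m).filter fun k => D k < δ).card : ℝ) ≤ ⌈ε / 2 * m⌉₊ := by
    exact_mod_cast h1
  have h3 : (⌈ε / 2 * m⌉₊ : ℝ) < ε / 2 * m + 1 := Nat.ceil_lt_add_one (by positivity)
  linarith

lemma limsup_freqBelow_eq_one
    (h : ∀ ε : ℝ, 0 < ε → ∀ M : ℕ, ∃ m ≥ M, ∀ k : ℕ, ε * m ≤ k → k < m → D k < δ) :
    limsup (freqBelow D δ) atTop = 1 := by
  refine le_antisymm (limsup_le_of_le isBoundedUnder_ge_freqBelow.isCoboundedUnder_le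
    (Eventually.of_forall freqBelow_le_one)) ?_
  refine le_of_forall_pos_sub_le fun ε hε => ?_
  refine le_limsup_of_frequently_le ?_ isBoundedUnder_le_freqBelow
  rw [frequently_atTop]
  intro M
  obtain ⟨m, hm, hk⟩ := h (ε / 2) (by positivity) (max M ⌈2 / ε⌉₊)
  exact ⟨m, le_of_max_le_left hm,
    le_freqBelow hε (Nat.ceil_le.1 (le_of_max_le_right hm)) hk⟩

lemma liminf_freqBelow_eq_zero
    (h : ∀ ε : ℝ, 0 < ε → ∀ M : ℕ, ∃ m ≥ M, ∀ k : ℕ, ε * m ≤ k → k < m → δ ≤ D k) :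
    liminf (freqBelow D δ) atTop = 0 := by
  refine le_antisymm ?_ (le_liminf_of_le isBoundedUnder_le_freqBelow.isCoboundedUnder_ge
    (Eventually.of_forall freqBelow_nonneg))
  refine le_of_forall_pos_le_add fun ε hε => ?_
  rw [zero_add]
  refine liminf_le_of_frequently_le ?_ isBoundedUnder_ge_freqBelow
  rw [frequently_atTop]
  intro M
  obtain ⟨m, hm, hk⟩ := h (ε / 2) (by positivity) (max M ⌈2 / ε⌉₊)
  exact ⟨m, le_of_max_le_left hm,
    freqBelow_le hε (Nat.ceil_le.1 (le_of_max_le_right hm)) hk⟩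

end Frequency

section SlowOscillation

open Real

lemma log_interval_near_phase (c : ℝ) : ∃ κ > 0, ∀ n : ℕ, ∀ᶠ m : ℕ in atTop,
    ∃ p q : ℕ, 0 < p ∧ q ≤ m ∧ κ * m ≤ (q : ℝ) - p ∧
      ∀ k, p ≤ k → k < q → 1 / 2 ≤ cos (log ((n + k : ℕ) + 1) - c) := by
  refine ⟨exp (-(2 * π + 1)) / 2, by positivity, fun n => ?_⟩
  have hlarge := tendsto_natCast_atTop_atTop (R := ℝ).eventually
    (eventually_ge_atTop (exp (2 * π + 1) * (2 * n + 4)))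
  filter_upwards [hlarge, eventually_gt_atTop 0] with m hm hm0
  have hm' : (0 : ℝ) < m := by exact_mod_cast hm0
  set j : ℤ := ⌊(log m - 1 - c) / (2 * π)⌋ with hj
  set T := exp (c + j * (2 * π)) with hT
  have hpi := pi_pos
  have hj1 : c + j * (2 * π) + 1 ≤ log m := by
    have := Int.floor_le ((log m - 1 - c) / (2 * π))
    rw [← hj, le_div_iff₀ (by positivity)] at this
    linarith
  have hj2 : log m < c + j * (2 * π) + (2 * π + 1) := by
    have := Int.lt_floor_add_one ((log m - 1 - c) / (2 * π))
    rw [← hj, div_lt_iff₀ (by positivity)] at this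
    linarith
  have hT0 : 0 < T := exp_pos _
  have he : (2.7 : ℝ) < exp 1 := by linarith [exp_one_gt_d9]
  have hTm : T * exp 1 ≤ m := by
    rw [hT, ← exp_add, ← le_log_iff_exp_le hm']
    exact hj1
  have hmT : (m : ℝ) < T * exp (2 * π + 1) := by
    rw [hT, ← exp_add, ← log_lt_iff_lt_exp hm']
    exact hj2
  have hTn : 2 * n + 4 ≤ T := by
    have := exp_pos (2 * π + 1)
    by_contra hcon
    nlinarith
  have hn : (0 : ℝ) ≤ n := Nat.cast_nonneg n
  refine ⟨⌈T⌉₊, ⌊2 * T⌋₊, Nat.ceil_pos.2 hT0, ?_, ?_, fun k hk1 hk2 => ?_⟩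
  · have : (⌊2 * T⌋₊ : ℝ) ≤ 2 * T := Nat.floor_le (by positivity)
    have : (⌊2 * T⌋₊ : ℝ) ≤ m := by nlinarith
    exact_mod_cast this
  · have h1 : (⌈T⌉₊ : ℝ) < T + 1 := Nat.ceil_lt_add_one hT0.le
    have h2 : 2 * T - 1 < (⌊2 * T⌋₊ : ℝ) := Nat.sub_one_lt_floor _
    have h3 : exp (-(2 * π + 1)) * m ≤ T := by
      rw [exp_neg, inv_mul_le_iff₀ (exp_pos _), mul_comm]
      exact hmT.le
    linarith
  · have h1 : T ≤ k := Nat.ceil_le.1 hk1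
    have h2 : (k : ℝ) ≤ 2 * T := (Nat.le_floor_iff (by positivity)).1 hk2.le
    push_cast
    have hpos : (0 : ℝ) < n + k + 1 := by linarith
    have h3 : c + j * (2 * π) ≤ log (n + k + 1) := by
      rw [le_log_iff_exp_le hpos]
      linarith
    have h4 : log (n + k + 1) ≤ c + j * (2 * π) + 1 := by
      rw [log_le_iff_le_exp hpos, exp_add]
      nlinarith
    have h5 := one_sub_sq_div_two_le_cos (x := log (n + k + 1) - c - j * (2 * π))
    rw [cos_sub_int_mul_two_pi] at h5
    nlinarith

lemma loglog_window_near_phase (c : ℝ) {ρ ε : ℝ} (hρ : 0 < ρ) (hε : 0 < ε) (M : ℕ) :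
    ∃ m ≥ M, ∀ k : ℕ, ε * m ≤ k → k < m →
      1 - ρ ^ 2 / 2 ≤ cos (log (1 + log ((k : ℝ) + 1)) - c) := by
  wlog hε1 : ε ≤ 1 generalizing ε
  · obtain ⟨m, hm, hk⟩ := this one_pos le_rfl
    refine ⟨m, hm, fun k h1 h2 => hk k (le_trans ?_ h1) h2⟩
    have : (0 : ℝ) ≤ m := Nat.cast_nonneg m
    nlinarith
  have hpi := pi_pos
  have hθ : Tendsto (fun j : ℕ => c + j * (2 * π)) atTop atTop :=
    tendsto_atTop_add_const_left _ _
      (tendsto_natCast_atTop_atTop.atTop_mul_const (by positivity))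
  have hexp := tendsto_exp_atTop.comp hθ
  have hρ1 : exp (-ρ) < 1 := by rw [exp_lt_one_iff]; linarith
  obtain ⟨j, hj1, hj2⟩ := ((hexp.eventually (eventually_ge_atTop
    (-log ε / (1 - exp (-ρ))))).and ((tendsto_exp_atTop.comp
      (tendsto_atTop_add_const_right _ (-1) hexp)).eventually
        (eventually_ge_atTop (M : ℝ)))).exists
  simp only [Function.comp_apply] at hj1 hj2
  set θ := c + j * (2 * π) with hθdef
  set R := exp (exp θ + -1) with hR
  have hR0 : 0 < R := exp_pos _
  have hlogR : log R = exp θ + -1 := log_exp _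
  refine ⟨⌊R⌋₊, Nat.le_floor hj2, fun k hk1 hk2 => ?_⟩
  have hk0 : (0 : ℝ) < k + 1 := by positivity
  have hkR : (k : ℝ) + 1 ≤ R := by
    have h1 : k + 1 ≤ ⌊R⌋₊ := hk2
    have := (Nat.le_floor_iff hR0.le).1 h1
    exact_mod_cast this
  have hlog0 : 0 ≤ log ((k : ℝ) + 1) := log_nonneg (by linarith [(Nat.cast_nonneg k : (0:ℝ) ≤ k)])
  have hupper : log (1 + log ((k : ℝ) + 1)) ≤ θ := by
    rw [log_le_iff_le_exp (by linarith)]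
    have := log_le_log hk0 hkR
    linarith
  have hlower : θ - ρ ≤ log (1 + log ((k : ℝ) + 1)) := by
    rw [le_log_iff_exp_le (by linarith), sub_eq_add_neg, exp_add]
    have h1 : ε * R ≤ k + 1 := by
      have := Nat.lt_floor_add_one R
      nlinarith
    have h2 := log_le_log (by positivity) h1
    rw [log_mul hε.ne' hR0.ne', hlogR] at h2
    rw [div_le_iff₀ (by linarith)] at hj1
    linarith
  have h := one_sub_sq_div_two_le_cos (x := log (1 + log ((k : ℝ) + 1)) - c - j * (2 * π))
  rw [cos_sub_nat_mul_two_pi] at h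
  nlinarith

lemma log_succ_sub_log_le (n : ℕ) :
    log ((n + 1 : ℕ) + 1) - log ((n : ℝ) + 1) ≤ invSucc n := by
  have h := log_le_sub_one_of_pos (x := ((n + 1 : ℕ) + 1 : ℝ) / (n + 1)) (by positivity)
  rw [log_div (by positivity) (by positivity)] at h
  refine h.trans (le_of_eq ?_)
  unfold invSucc
  push_cast
  field_simp
  ring

lemma log_le_log_succ (n : ℕ) : log ((n : ℝ) + 1) ≤ log ((n + 1 : ℕ) + 1) :=
  log_le_log (by positivity) (by push_cast; linarith)

lemma half_one_add_sin_mem (x : ℝ) : (1 + sin x) / 2 ∈ unitInterval :=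
  ⟨by linarith [neg_one_le_sin x], by linarith [sin_le_one x]⟩

/-- An oscillation at logarithmic speed. -/
noncomputable def logWave (n : ℕ) : unitInterval :=
  ⟨(1 + sin (log ((n : ℝ) + 1))) / 2, half_one_add_sin_mem _⟩

/-- An oscillation at doubly logarithmic speed. -/
noncomputable def loglogWave (n : ℕ) : unitInterval :=
  ⟨(1 + sin (log (1 + log ((n : ℝ) + 1)))) / 2, half_one_add_sin_mem _⟩

lemma dist_half_one_add_sin_le {x y t : ℝ} (hxy : y ≤ x) (h : x - y ≤ t) :
    |(1 + sin x) / 2 - (1 + sin y) / 2| ≤ t := by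
  have h1 := abs_sin_sub_sin_le x y
  have h2 : |x - y| = x - y := abs_of_nonneg (by linarith)
  have h3 : (1 + sin x) / 2 - (1 + sin y) / 2 = (sin x - sin y) / 2 := by ring
  rw [h3, abs_div, abs_two]
  linarith [abs_nonneg (sin x - sin y)]

lemma dist_logWave_succ_le (n : ℕ) : dist (logWave (n + 1)) (logWave n) ≤ invSucc n :=
  dist_half_one_add_sin_le (log_le_log_succ n) (log_succ_sub_log_le n)

lemma dist_loglogWave_succ_le (n : ℕ) :
    dist (loglogWave (n + 1)) (loglogWave n) ≤ invSucc n := by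
  have h0 : 0 ≤ log ((n : ℝ) + 1) := log_nonneg (by linarith [(Nat.cast_nonneg n : (0:ℝ) ≤ n)])
  have h1 := log_le_log_succ n
  refine dist_half_one_add_sin_le (log_le_log (by linarith) (by linarith)) ?_
  rw [← log_div (by linarith) (by linarith)]
  refine (log_le_sub_one_of_pos (div_pos (by linarith) (by linarith))).trans ?_
  rw [div_sub_one (by linarith)]
  refine (div_le_self (by linarith) (by linarith)).trans ?_
  linarith [log_succ_sub_log_le n]

end SlowOscillation

/-- The limit part of the extension: two slow phases and a `2`-adic odometer. -/
abbrev PhaseSpace : Type := unitInterval × unitInterval × ℤ_[2]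

/-- The base points of the transient orbit. -/
noncomputable def phaseSeq (n : ℕ) : PhaseSpace := (logWave n, loglogWave n, (n : ℤ_[2]))

/-- The odometer acting on the phase space. -/
noncomputable def odometer (x : PhaseSpace) : PhaseSpace := (x.1, x.2.1, x.2.2 + 1)

lemma isometry_odometer : Isometry odometer :=
  Isometry.of_dist_eq fun x y => by simp [odometer, Prod.dist_eq]

lemma dist_phaseSeq_succ_le (n : ℕ) :
    dist (phaseSeq (n + 1)) (odometer (phaseSeq n)) ≤ invSucc n := by
  refine max_le (dist_logWave_succ_le n) (max_le (dist_loglogWave_succ_le n) ?_)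
  simp [odometer, phaseSeq, (invSucc_pos n).le]

lemma dist_odometer_iterate (x y : PhaseSpace) (k : ℕ) :
    dist (odometer^[k] x) (odometer^[k] y) = dist x y := by
  induction k with
  | zero => rfl
  | succ k ih =>
    rw [Function.iterate_succ_apply', Function.iterate_succ_apply',
      isometry_odometer.dist_eq, ih]

lemma odometer_iterate_fst (x : PhaseSpace) (k : ℕ) : (odometer^[k] x).1 = x.1 := by
  induction k with
  | zero => rfl
  | succ k ih => rw [Function.iterate_succ_apply', ← ih]; rfl

/-- The extension: the orbit space times a constant label. -/
abbrev LabelledExt : Type := OrbitExt phaseSeq × unitInterval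

/-- The map of the extension. -/
noncomputable def labelledShift (x : LabelledExt) : LabelledExt :=
  (OrbitExt.shift odometer x.1, x.2)

lemma continuous_labelledShift : Continuous labelledShift :=
  ((OrbitExt.continuous_shift isometry_odometer dist_phaseSeq_succ_le).comp
    continuous_fst).prodMk continuous_snd

lemma labelledShift_iterate (e : OrbitExt phaseSeq) (a : unitInterval) (k : ℕ) :
    labelledShift^[k] (e, a) = ((OrbitExt.shift odometer)^[k] e, a) := by
  induction k with
  | zero => rfl
  | succ k ih => rw [Function.iterate_succ_apply', ih, Function.iterate_succ_apply']; rfl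

open OrbitExt in
lemma exists_freq_orbit_limit_lt_one (n : ℕ) (x : PhaseSpace) :
    ∃ δ > 0, limsup (freqBelow (fun k => dist
      ((shift odometer)^[k] (orbit n : OrbitExt phaseSeq))
      ((shift odometer)^[k] (limit x : OrbitExt phaseSeq))) δ) atTop < 1 := by
  have hdist : ∀ k : ℕ, |(logWave (n + k) : ℝ) - x.1| ≤ dist
      ((shift odometer)^[k] (orbit n : OrbitExt phaseSeq))
      ((shift odometer)^[k] (limit x : OrbitExt phaseSeq)) := by
    intro k
    rw [shift_iterate_orbit, shift_iterate_limit]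
    refine le_trans ?_ (dist_base_le _ _)
    refine le_trans (le_of_eq ?_) (le_max_left _ _)
    change _ = dist (logWave (n + k)) (odometer^[k] x).1
    rw [odometer_iterate_fst]
    rfl
  refine ⟨1 / 4, by norm_num, ?_⟩
  rcases le_total (x.1 : ℝ) (1 / 2) with hx | hx
  · obtain ⟨κ, hκ, h⟩ := log_interval_near_phase (Real.pi / 2)
    refine limsup_freqBelow_lt_one hκ ((h n).mono ?_)
    rintro m ⟨p, q, hp, hq, hpq, hk⟩
    refine ⟨p, q, hp, hq, hpq, fun k h1 h2 => le_trans ?_ (hdist k)⟩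
    have h3 := hk k h1 h2
    rw [Real.cos_sub_pi_div_two] at h3
    refine le_trans ?_ (le_abs_self _)
    simp only [logWave]
    linarith
  · obtain ⟨κ, hκ, h⟩ := log_interval_near_phase (-(Real.pi / 2))
    refine limsup_freqBelow_lt_one hκ ((h n).mono ?_)
    rintro m ⟨p, q, hp, hq, hpq, hk⟩
    refine ⟨p, q, hp, hq, hpq, fun k h1 h2 => le_trans ?_ (hdist k)⟩
    have h3 := hk k h1 h2
    rw [sub_neg_eq_add, Real.cos_add_pi_div_two] at h3
    refine le_trans ?_ (neg_abs_le _ |> neg_le.1)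
    simp only [logWave]
    linarith

open OrbitExt in
lemma exists_upperDF_labelledShift_lt_one {u v : LabelledExt} (huv : u ≠ v) :
    ∃ δ > 0, upperDF labelledShift u v δ < 1 := by
  obtain ⟨e, a⟩ := u
  obtain ⟨e', a'⟩ := v
  change ∃ δ > 0, limsup (freqBelow (fun k =>
    dist (labelledShift^[k] (e, a)) (labelledShift^[k] (e', a'))) δ) atTop < 1
  simp only [labelledShift_iterate]
  by_cases ha : a = a'
  · subst ha
    have he : e ≠ e' := fun h => huv (by rw [h])
    have hdist : ∀ x y : OrbitExt phaseSeq, dist (x, a) (y, a) = dist x y := fun x y => by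
      simp [Prod.dist_eq]
    simp only [hdist]
    rcases e with x | n <;> rcases e' with y | m
    · have hxy : x ≠ y := fun h => he (by rw [h])
      refine ⟨dist x y, dist_pos.2 hxy, limsup_freqBelow_lt_one_of_forall_le fun k => ?_⟩
      rw [shift_iterate_limit, shift_iterate_limit]
      refine le_trans (le_of_eq ?_) (dist_base_le _ _)
      exact (dist_odometer_iterate x y k).symm
    · simp only [dist_comm ((shift odometer)^[_] (limit x : OrbitExt phaseSeq))]
      exact exists_freq_orbit_limit_lt_one m x
    · exact exists_freq_orbit_limit_lt_one n y
    · have hnm : (n : ℤ_[2]) ≠ m := fun h => he (by rw [Nat.cast_injective h])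
      refine ⟨dist (n : ℤ_[2]) m, dist_pos.2 hnm,
        limsup_freqBelow_lt_one_of_forall_le fun k => ?_⟩
      rw [shift_iterate_orbit, shift_iterate_orbit]
      refine le_trans ?_ (dist_base_le _ _)
      refine le_trans (le_of_eq ?_) ((le_max_right _ _).trans (le_max_right _ _))
      simp [base, phaseSeq]
  · exact ⟨dist a a', dist_pos.2 ha,
      limsup_freqBelow_lt_one_of_forall_le fun k => le_max_right _ _⟩

/-- The amplitude of the label at time `n` in the factor. -/
noncomputable def amplitude (n : ℕ) : ℝ := loglogWave n + invSucc n

lemma amplitude_pos (n : ℕ) : 0 < amplitude n :=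
  add_pos_of_nonneg_of_pos (loglogWave n).2.1 (invSucc_pos n)

/-- The factor: a limit rectangle together with one transient orbit for every label. -/
inductive FadedSpace : Type
  | limit (w q : unitInterval)
  | orbit (n : ℕ) (a : unitInterval)

namespace FadedSpace

/-- The embedding into Euclidean space, where labels are scaled by the amplitude. -/
noncomputable def embed : FadedSpace → ℝ × ℝ × ℝ
  | limit w q => (0, w, q)
  | orbit n a => (invSucc n, logWave n, amplitude n * a)

lemma embed_injective : Function.Injective embed := by
  rintro (⟨w, q⟩ | ⟨n, a⟩) (⟨w', q'⟩ | ⟨m, b⟩) h <;>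
    simp only [embed, Prod.mk.injEq] at h
  · rw [Subtype.ext h.2.1, Subtype.ext h.2.2]
  · exact absurd h.1 (invSucc_pos m).ne
  · exact absurd h.1 (invSucc_pos n).ne'
  · obtain rfl := invSucc_strictAnti.injective h.1
    rw [Subtype.ext (mul_left_cancel₀ (amplitude_pos n).ne' h.2.2)]

noncomputable instance : MetricSpace FadedSpace :=
  MetricSpace.induced embed embed_injective inferInstance

lemma isometry_embed : Isometry embed := Isometry.of_dist_eq fun _ _ => rfl

lemma dist_orbit (n : ℕ) (a b : unitInterval) :
    dist (orbit n a) (orbit n b) = amplitude n * |(a : ℝ) - b| := by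
  change dist (embed (orbit n a)) (embed (orbit n b)) = _
  simp only [embed, Prod.dist_eq, dist_self, Real.dist_eq]
  rw [← mul_sub, abs_mul, abs_of_pos (amplitude_pos n), max_eq_right, max_eq_right]
  · exact mul_nonneg (amplitude_pos n).le (abs_nonneg _)
  · exact le_max_left _ _

/-- The map of the factor. -/
def shift : FadedSpace → FadedSpace
  | limit w q => limit w q
  | orbit n a => orbit (n + 1) a

/-- The factor map. -/
noncomputable def proj : LabelledExt → FadedSpace
  | (OrbitExt.limit x, a) => limit x.1 (x.2.1 * a)
  | (OrbitExt.orbit n, a) => orbit n a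

lemma embed_proj (u : LabelledExt) : embed (proj u) =
    (u.1.height, (u.1.base.1 : ℝ), ((u.1.base.2.1 : ℝ) + u.1.height) * u.2) := by
  rcases u with ⟨x | n, a⟩
  · simp [proj, embed, OrbitExt.height, OrbitExt.base]
  · rfl

lemma continuous_proj : Continuous proj := by
  rw [isometry_embed.isEmbedding.continuous_iff]
  have h1 : Continuous fun u : LabelledExt => u.1.height :=
    OrbitExt.continuous_height.comp continuous_fst
  have h2 : Continuous fun u : LabelledExt => u.1.base :=
    OrbitExt.continuous_base.comp continuous_fst
  have h3 : embed ∘ proj = fun u : LabelledExt =>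
      (u.1.height, (u.1.base.1 : ℝ), ((u.1.base.2.1 : ℝ) + u.1.height) * u.2) :=
    funext embed_proj
  rw [h3]
  fun_prop

lemma proj_surjective : Function.Surjective proj := by
  rintro (⟨w, q⟩ | ⟨n, a⟩)
  · exact ⟨(OrbitExt.limit (w, 1, 0), q), by simp [proj]⟩
  · exact ⟨(OrbitExt.orbit n, a), rfl⟩

lemma proj_comp_labelledShift : proj ∘ labelledShift = shift ∘ proj := by
  funext u
  rcases u with ⟨x | n, a⟩ <;> rfl

instance : CompactSpace FadedSpace :=
  proj_surjective.compactSpace continuous_proj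

lemma continuous_shift : Continuous shift := by
  rw [(continuous_proj.isClosedMap.isQuotientMap continuous_proj
    proj_surjective).continuous_iff, ← proj_comp_labelledShift]
  exact continuous_proj.comp continuous_labelledShift

lemma shift_iterate_orbit (a : unitInterval) (k : ℕ) :
    shift^[k] (orbit 0 a) = orbit k a := by
  induction k with
  | zero => rfl
  | succ k ih => rw [Function.iterate_succ_apply', ih]; rfl

lemma exists_window_amplitude_lt {η ε : ℝ} (hη : 0 < η) (hε : 0 < ε) (M : ℕ) :
    ∃ m ≥ M, ∀ k : ℕ, ε * m ≤ k → k < m → amplitude k < η := by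
  obtain ⟨N, hN⟩ := (tendsto_invSucc.eventually (gt_mem_nhds (half_pos hη))).exists
  obtain ⟨m, hm, hk⟩ := loglog_window_near_phase (-(Real.pi / 2)) (ρ := min 1 η)
    (by positivity) hε (max M ⌈(N : ℝ) / ε⌉₊)
  refine ⟨m, le_of_max_le_left hm, fun k h1 h2 => ?_⟩
  have h3 := hk k h1 h2
  rw [sub_neg_eq_add, Real.cos_add_pi_div_two] at h3
  have h4 : N ≤ k := by
    have h5 := Nat.ceil_le.1 (le_of_max_le_right hm)
    rw [div_le_iff₀ hε] at h5
    have : (N : ℝ) ≤ k := by linarith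
    exact_mod_cast this
  have h5 := invSucc_strictAnti.antitone h4
  have h6 : (min 1 η) ^ 2 ≤ η := by
    have := min_le_left 1 η
    have := min_le_right 1 η
    have : 0 < min 1 η := by positivity
    nlinarith
  simp only [amplitude, loglogWave]
  linarith

lemma exists_window_le_amplitude {ε : ℝ} (hε : 0 < ε) (M : ℕ) :
    ∃ m ≥ M, ∀ k : ℕ, ε * m ≤ k → k < m → 1 / 2 ≤ amplitude k := by
  obtain ⟨m, hm, hk⟩ := loglog_window_near_phase (Real.pi / 2) one_pos hε M
  refine ⟨m, hm, fun k h1 h2 => ?_⟩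
  have h3 := hk k h1 h2
  rw [Real.cos_sub_pi_div_two] at h3
  have := invSucc_pos k
  simp only [amplitude, loglogWave]
  linarith

lemma distScrambled1_orbit {a b : unitInterval} (hab : a ≠ b) :
    DistScrambled1 shift (orbit 0 a) (orbit 0 b) := by
  have hpos : 0 < |(a : ℝ) - b| := abs_pos.2 (sub_ne_zero.2 (Subtype.coe_injective.ne hab))
  have hD : ∀ k : ℕ, dist (shift^[k] (orbit 0 a)) (shift^[k] (orbit 0 b)) =
      amplitude k * |(a : ℝ) - b| := fun k => by
    rw [shift_iterate_orbit, shift_iterate_orbit, dist_orbit]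
  refine ⟨by simpa using hab, fun δ hδ => limsup_freqBelow_eq_one fun ε hε M => ?_,
    1 / 2 * |(a : ℝ) - b|, by positivity, ?_, liminf_freqBelow_eq_zero fun ε hε M => ?_⟩
  · obtain ⟨m, hm, hk⟩ := exists_window_amplitude_lt (div_pos hδ hpos) hε M
    refine ⟨m, hm, fun k h1 h2 => ?_⟩
    rw [hD, ← lt_div_iff₀ hpos]
    exact hk k h1 h2
  · refine le_trans ?_ (dist_le_diam_of_mem isCompact_univ.isBounded
      (Set.mem_univ (orbit 0 a)) (Set.mem_univ (orbit 0 b)))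
    rw [dist_orbit]
    have h0 : (1 : ℝ) / 2 ≤ amplitude 0 := by
      norm_num [amplitude, loglogWave, invSucc]
    gcongr
  · obtain ⟨m, hm, hk⟩ := exists_window_le_amplitude hε M
    refine ⟨m, hm, fun k h1 h2 => ?_⟩
    rw [hD]
    gcongr
    exact hk k h1 h2

lemma not_countable_range_orbit : ¬ (Set.range (orbit 0)).Countable := by
  intro h
  have hinj : Function.Injective (orbit 0) := fun a b hab => by simpa using hab
  rw [← Set.image_univ] at h
  have hI : (Set.univ : Set unitInterval).Countable :=
    Set.countable_of_injective_of_countable_image hinj.injOn h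
  have hIcc := hI.image ((↑) : unitInterval → ℝ)
  rw [Set.image_univ, Subtype.range_coe, ← Cardinal.le_aleph0_iff_set_countable,
    Cardinal.mk_Icc_real zero_lt_one] at hIcc
  exact absurd hIcc (not_le.2 Cardinal.aleph0_lt_continuum)

end FadedSpace

/-- There exist a semiconjugacy `π` from `(X, F)` onto `(Y, f)` such that `(Y, f)`
has an uncountable set whose distinct pairs are all distributionally scrambled of
type 1, while in `(X, F)` every pair of distinct points `u, v` satisfies
`Φ*_{(u,v)}(δ) < 1` for some `δ > 0`. -/
theorem stmt1 :
    ∃ (X Y : Type) (_ : MetricSpace X) (_ : MetricSpace Y)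
      (_ : CompactSpace X) (_ : CompactSpace Y)
      (F : X → X) (f : Y → Y) (π : X → Y),
      Continuous F ∧ Continuous f ∧ Continuous π ∧ Function.Surjective π ∧
      π ∘ F = f ∘ π ∧
      (∃ S : Set Y, ¬ S.Countable ∧
        ∀ u ∈ S, ∀ v ∈ S, u ≠ v → DistScrambled1 f u v) ∧
      (∀ u v : X, u ≠ v → ∃ δ > 0, upperDF F u v δ < 1) := by
  refine ⟨LabelledExt, FadedSpace, inferInstance, inferInstance, inferInstance, inferInstance,
    labelledShift, FadedSpace.shift, FadedSpace.proj, continuous_labelledShift,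
    FadedSpace.continuous_shift, FadedSpace.continuous_proj, FadedSpace.proj_surjective,
    FadedSpace.proj_comp_labelledShift,
    ⟨Set.range (FadedSpace.orbit 0), FadedSpace.not_countable_range_orbit, ?_⟩,
    fun u v huv => exists_upperDF_labelledShift_lt_one huv⟩
  rintro _ ⟨a, rfl⟩ _ ⟨b, rfl⟩ hab
  exact FadedSpace.distScrambled1_orbit fun h => hab (by rw [h])
end
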